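/- Suppose u : Ω → ℝ is C¹ with gradient ∇u bounded and uniformly continuous on Ω. Then lim_{n→∞} R_n(u) = ∫_Ω |∇u(x)| dx, where |∇u(x)| = (∂₁u(x)² + ∂₂u(x)²)^{1/2} is the Euclidean norm of the gradient. -/

import Mathlib

open MeasureTheory
open scoped ENNReal

/-- The point of `ℝ²` with integer coordinates `k`. -/
noncomputable def ivec (k : Fin 2 → ℤ) : EuclideanSpace ℝ (Fin 2) := WithLp.toLp 2 fun i => (k i : ℝ)

/-- Partial derivative `∂_j u` of a scalar function. -/
noncomputable def pd (j : Fin 2) (u : EuclideanSpace ℝ (Fin 2) → ℝ)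
    (x : EuclideanSpace ℝ (Fin 2)) : ℝ :=
  fderiv ℝ u x (EuclideanSpace.single j 1)

/-- The wavelet coefficient
`c_{n,j}[u;k] = (∫φ_j)⁻¹ ∫_Ω ∂_j u(x) · 2^{2(n−1)} φ_j(2^{n−1}(x − 2^{−n}k)) dx`. -/
noncomputable def cnj (Ω : Set (EuclideanSpace ℝ (Fin 2)))
    (φ : Fin 2 → EuclideanSpace ℝ (Fin 2) → ℝ) (u : EuclideanSpace ℝ (Fin 2) → ℝ)
    (n : ℕ) (j : Fin 2) (k : Fin 2 → ℤ) : ℝ :=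
  (∫ y, φ j y)⁻¹ * ∫ x in Ω, pd j u x *
    ((2 : ℝ) ^ (2 * ((n : ℤ) - 1)) *
      φ j ((2 : ℝ) ^ ((n : ℤ) - 1) • (x - (2 : ℝ) ^ (-(n : ℤ)) • ivec k)))

/-- `c_n[u;k] = (c_{n,1}[u;k]² + c_{n,2}[u;k]²)^{1/2}`. -/
noncomputable def cn (Ω : Set (EuclideanSpace ℝ (Fin 2)))
    (φ : Fin 2 → EuclideanSpace ℝ (Fin 2) → ℝ) (u : EuclideanSpace ℝ (Fin 2) → ℝ)
    (n : ℕ) (k : Fin 2 → ℤ) : ℝ :=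
  Real.sqrt (cnj Ω φ u n 0 k ^ 2 + cnj Ω φ u n 1 k ^ 2)

/-- The admissible lattice `𝕂_n`. -/
def Kn (Ω : Set (EuclideanSpace ℝ (Fin 2))) (Cw : ℝ) (n : ℕ) : Set (Fin 2 → ℤ) :=
  {k | Metric.closedBall ((2 : ℝ) ^ (-(n : ℤ)) • ivec k) ((2 : ℝ) ^ (-((n : ℤ) - 1)) * Cw) ⊆ Ω}

/-- The two-scale radius `H_n = 2^{−n/2}`. -/
noncomputable def Hrad (n : ℕ) : ℝ := (2 : ℝ) ^ (-(n : ℝ) / 2)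

/-- The truncation threshold `M_n = α/(2 H_n)`. -/
noncomputable def Mthr (α : ℝ) (n : ℕ) : ℝ := α / (2 * Hrad n)

/-- The lattice neighbourhood `B_{n,k}`. -/
noncomputable def Bnk (Ω : Set (EuclideanSpace ℝ (Fin 2))) (Cw : ℝ) (n : ℕ)
    (k : Fin 2 → ℤ) : Set (Fin 2 → ℤ) :=
  {l ∈ Kn Ω Cw n | ‖(2 : ℝ) ^ (-(n : ℤ)) • ivec l - (2 : ℝ) ^ (-(n : ℤ)) • ivec k‖ ≤ Hrad n}

/-- The truncated two-scale coefficient `ĉ_n[u;k] = min{M_n, max_{l ∈ B_{n,k}} c_n[u;l]}`. -/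
noncomputable def chat (Ω : Set (EuclideanSpace ℝ (Fin 2)))
    (φ : Fin 2 → EuclideanSpace ℝ (Fin 2) → ℝ) (Cw α : ℝ)
    (u : EuclideanSpace ℝ (Fin 2) → ℝ) (n : ℕ) (k : Fin 2 → ℤ) : ℝ :=
  min (Mthr α n) (⨆ (l : Fin 2 → ℤ) (_ : l ∈ Bnk Ω Cw n k), cn Ω φ u n l)

/-- The regularity energy `R_n(u) = 2^{−2n} Σ_{k ∈ 𝕂_n} ĉ_n[u;k]`. -/
noncomputable def Rn (Ω : Set (EuclideanSpace ℝ (Fin 2)))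
    (φ : Fin 2 → EuclideanSpace ℝ (Fin 2) → ℝ) (Cw α : ℝ)
    (u : EuclideanSpace ℝ (Fin 2) → ℝ) (n : ℕ) : ℝ :=
  (2 : ℝ) ^ (-(2 * (n : ℤ))) * ∑' k : Kn Ω Cw n, chat Ω φ Cw α u n k

/-- Rescaling a kernel in the plane so as to preserve its mass. -/
theorem integral_dilation_translate (f : EuclideanSpace ℝ (Fin 2) → ℝ) (m : ℤ)
    (p : EuclideanSpace ℝ (Fin 2)) :
    ∫ x, (2 : ℝ) ^ (2 * m) * f ((2 : ℝ) ^ m • (x - p)) = ∫ y, f y := by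
  have hm : (0 : ℝ) < (2 : ℝ) ^ m := by positivity
  rw [integral_const_mul, integral_sub_right_eq_self (fun z => f ((2 : ℝ) ^ m • z)) p,
    Measure.integral_comp_smul, finrank_euclideanSpace_fin, abs_of_pos (by positivity),
    smul_eq_mul, ← mul_assoc, mul_comm 2 m, zpow_mul, zpow_ofNat, mul_inv_cancel₀ (by positivity),
    one_mul]

/-- The coefficients are weighted averages of the partial derivative over the kernel's ball. -/
theorem abs_cnj_sub_le {Ω : Set (EuclideanSpace ℝ (Fin 2))} (hΩ : MeasurableSet Ω)
    {φ : Fin 2 → EuclideanSpace ℝ (Fin 2) → ℝ} {Cw : ℝ}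
    {j : Fin 2} (hcont : Continuous (φ j)) (hnonneg : ∀ y, 0 ≤ φ j y)
    (hne : ∃ y, φ j y ≠ 0)
    (hsupp : Function.support (φ j) ⊆ Metric.closedBall (0 : EuclideanSpace ℝ (Fin 2)) Cw)
    {u : EuclideanSpace ℝ (Fin 2) → ℝ} {B : ℝ} (hB : ∀ x ∈ Ω, |pd j u x| ≤ B)
    {n : ℕ} {k : Fin 2 → ℤ} (hk : k ∈ Kn Ω Cw n) {c ε : ℝ}
    (hc : ∀ y ∈ Metric.closedBall ((2 : ℝ) ^ (-(n : ℤ)) • ivec k)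
      ((2 : ℝ) ^ (-((n : ℤ) - 1)) * Cw), |pd j u y - c| ≤ ε) :
    |cnj Ω φ u n j k - c| ≤ ε := by
  set p := (2 : ℝ) ^ (-(n : ℤ)) • ivec k
  set m : ℤ := (n : ℤ) - 1
  set K : EuclideanSpace ℝ (Fin 2) → ℝ :=
    fun x => (2 : ℝ) ^ (2 * m) * φ j ((2 : ℝ) ^ m • (x - p))
  have hmpos : (0 : ℝ) < (2 : ℝ) ^ m := by positivity
  have hKnonneg : ∀ x, 0 ≤ K x := fun x => mul_nonneg (by positivity) (hnonneg _)
  have hKsupp : ∀ x, K x ≠ 0 → x ∈ Metric.closedBall p ((2 : ℝ) ^ (-m) * Cw) := by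
    intro x hx
    have h1 := hsupp (show (2 : ℝ) ^ m • (x - p) ∈ Function.support (φ j) from
      right_ne_zero_of_mul hx)
    rw [mem_closedBall_zero_iff, norm_smul, Real.norm_of_nonneg hmpos.le] at h1
    rw [mem_closedBall_iff_norm, zpow_neg, inv_mul_eq_div, le_div_iff₀ hmpos, mul_comm]
    exact h1
  have hKcont : Continuous K := by fun_prop
  have hKint : Integrable K := hKcont.integrable_of_hasCompactSupport
    (HasCompactSupport.intro (isCompact_closedBall p ((2 : ℝ) ^ (-m) * Cw))
      fun x hx => not_imp_comm.1 (hKsupp x) hx)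
  have hKmass : ∫ x in Ω, K x = ∫ y, φ j y := by
    rw [setIntegral_eq_integral_of_forall_compl_eq_zero
      fun x hx => not_imp_comm.1 (hKsupp x) fun h => hx (hk h)]
    exact integral_dilation_translate (φ j) m p
  have hmass : 0 < ∫ y, φ j y := by
    obtain ⟨y, hy⟩ := hne
    exact hcont.integral_pos_of_hasCompactSupport_nonneg_nonzero
      (HasCompactSupport.intro (isCompact_closedBall 0 Cw)
        fun x hx => not_imp_comm.1 (fun h => hsupp h) hx) hnonneg hy
  have hgK : IntegrableOn (fun x => pd j u x * K x) Ω :=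
    hKint.integrableOn.bdd_mul (c := B)
      (measurable_fderiv_apply_const ℝ u _).aestronglyMeasurable
      ((ae_restrict_iff' hΩ).2 (Filter.Eventually.of_forall hB))
  have hdiff : ∫ x in Ω, (pd j u x - c) * K x = (∫ x in Ω, pd j u x * K x) - c * ∫ y, φ j y := by
    simp_rw [sub_mul]
    rw [integral_sub hgK (hKint.integrableOn.const_mul c), integral_const_mul, hKmass]
  have hle : |∫ x in Ω, (pd j u x - c) * K x| ≤ ε * ∫ y, φ j y := by
    rw [← hKmass, ← integral_const_mul, ← Real.norm_eq_abs]
    refine norm_integral_le_of_norm_le (hKint.integrableOn.const_mul ε)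
      (Filter.Eventually.of_forall fun x => ?_)
    rw [norm_mul, Real.norm_eq_abs, Real.norm_of_nonneg (hKnonneg x)]
    by_cases hx : K x = 0
    · simp [hx]
    · exact mul_le_mul_of_nonneg_right (hc x (hKsupp x hx)) (hKnonneg x)
  have hcnj : cnj Ω φ u n j k - c = (∫ y, φ j y)⁻¹ * ∫ x in Ω, (pd j u x - c) * K x := by
    rw [hdiff, mul_sub, mul_comm c, inv_mul_cancel_left₀ hmass.ne']
    rfl
  rw [hcnj, abs_mul, abs_of_pos (inv_pos.2 hmass), inv_mul_le_iff₀ hmass, mul_comm]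
  exact hle

theorem sqrt_sq_add_sq_le (a b c d : ℝ) :
    √(a ^ 2 + b ^ 2) ≤ √(c ^ 2 + d ^ 2) + (|a - c| + |b - d|) := by
  have hs := Real.sqrt_nonneg (c ^ 2 + d ^ 2)
  have hsq := Real.sq_sqrt (show 0 ≤ c ^ 2 + d ^ 2 by positivity)
  have hc : |c| ≤ √(c ^ 2 + d ^ 2) := Real.abs_le_sqrt (by nlinarith [sq_nonneg d])
  have hd : |d| ≤ √(c ^ 2 + d ^ 2) := Real.abs_le_sqrt (by nlinarith [sq_nonneg c])
  have hp := abs_nonneg (a - c)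
  have hq := abs_nonneg (b - d)
  refine Real.sqrt_le_iff.2 ⟨by positivity, ?_⟩
  have ha : a ^ 2 ≤ c ^ 2 + 2 * (√(c ^ 2 + d ^ 2) * |a - c|) + |a - c| ^ 2 := by
    have h := mul_le_mul_of_nonneg_right hc hp
    rw [← abs_mul] at h
    nlinarith [le_abs_self (c * (a - c)), sq_abs (a - c)]
  have hb : b ^ 2 ≤ d ^ 2 + 2 * (√(c ^ 2 + d ^ 2) * |b - d|) + |b - d| ^ 2 := by
    have h := mul_le_mul_of_nonneg_right hd hq
    rw [← abs_mul] at h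
    nlinarith [le_abs_self (d * (b - d)), sq_abs (b - d)]
  nlinarith [mul_nonneg hp hq]

theorem abs_sqrt_sub_sqrt_le (a b c d : ℝ) :
    |√(a ^ 2 + b ^ 2) - √(c ^ 2 + d ^ 2)| ≤ |a - c| + |b - d| := by
  rw [abs_sub_le_iff]
  have h₁ := sqrt_sq_add_sq_le a b c d
  have h₂ := sqrt_sq_add_sq_le c d a b
  rw [abs_sub_comm c, abs_sub_comm d] at h₂
  constructor <;> linarith

theorem biSup_le_of_forall_mem_le {ι : Type*} {S : Set ι} {f : ι → ℝ} {b : ℝ} (hb : 0 ≤ b)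
    (h : ∀ l ∈ S, f l ≤ b) : ⨆ (l) (_ : l ∈ S), f l ≤ b :=
  Real.iSup_le (fun l => Real.iSup_le (h l) hb) hb

theorem le_biSup_of_mem {ι : Type*} {S : Set ι} {f : ι → ℝ} {b : ℝ} (hb : 0 ≤ b)
    (h : ∀ l ∈ S, f l ≤ b) {l : ι} (hl : l ∈ S) : f l ≤ ⨆ (l) (_ : l ∈ S), f l := by
  have hbdd : BddAbove (Set.range fun l => ⨆ (_ : l ∈ S), f l) :=
    ⟨b, Set.forall_mem_range.2 fun l => Real.iSup_le (h l) hb⟩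
  simpa [hl] using le_ciSup hbdd l

/-- The index of the dyadic cell of generation `n` containing `x`. -/
noncomputable def cellIndex (n : ℕ) (x : EuclideanSpace ℝ (Fin 2)) : Fin 2 → ℤ :=
  fun i => ⌊(2 : ℝ) ^ (n : ℤ) * x i⌋

theorem measurable_cellIndex (n : ℕ) : Measurable (cellIndex n) := by
  refine measurable_pi_lambda _ fun i => Int.measurable_floor.comp ?_
  fun_prop

theorem norm_sub_cellIndex_le (n : ℕ) (x : EuclideanSpace ℝ (Fin 2)) :
    ‖x - (2 : ℝ) ^ (-(n : ℤ)) • ivec (cellIndex n x)‖ ≤ 2 * (2 : ℝ) ^ (-(n : ℤ)) := by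
  have hpos : (0 : ℝ) < (2 : ℝ) ^ (n : ℤ) := by positivity
  have hcoord : ∀ i, |(x - (2 : ℝ) ^ (-(n : ℤ)) • ivec (cellIndex n x)) i| ≤
      (2 : ℝ) ^ (-(n : ℤ)) := by
    intro i
    have h : (x - (2 : ℝ) ^ (-(n : ℤ)) • ivec (cellIndex n x)) i =
        (2 : ℝ) ^ (-(n : ℤ)) * Int.fract ((2 : ℝ) ^ (n : ℤ) * x i) := by
      simp only [PiLp.sub_apply, PiLp.smul_apply, ivec, cellIndex, smul_eq_mul, Int.fract, zpow_neg]
      field_simp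
    rw [h, abs_of_nonneg (mul_nonneg (by positivity) (Int.fract_nonneg _))]
    exact mul_le_of_le_one_right (by positivity) (Int.fract_lt_one _).le
  rw [EuclideanSpace.norm_eq, Real.sqrt_le_iff]
  refine ⟨by positivity, ?_⟩
  rw [Fin.sum_univ_two]
  have h0 := pow_le_pow_left₀ (abs_nonneg _) (hcoord 0) 2
  have h1 := pow_le_pow_left₀ (abs_nonneg _) (hcoord 1) 2
  simp only [Real.norm_eq_abs]
  nlinarith [sq_nonneg ((2 : ℝ) ^ (-(n : ℤ)))]

theorem volume_real_cellIndex_preimage (n : ℕ) (k : Fin 2 → ℤ) :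
    volume.real (cellIndex n ⁻¹' {k}) = (2 : ℝ) ^ (-(2 * (n : ℤ))) := by
  have hpos : (0 : ℝ) < (2 : ℝ) ^ (n : ℤ) := by positivity
  set box : Set (Fin 2 → ℝ) := Set.univ.pi fun i =>
    Set.Ico ((k i : ℝ) / (2 : ℝ) ^ (n : ℤ)) ((k i + 1) / (2 : ℝ) ^ (n : ℤ)) with hbox
  have hset : cellIndex n ⁻¹' {k} =
      (WithLp.ofLp : EuclideanSpace ℝ (Fin 2) → _) ⁻¹' box := by
    ext x
    simp only [hbox, Set.mem_preimage, Set.mem_singleton_iff, funext_iff, cellIndex, Int.floor_eq_iff,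
      Set.mem_univ_pi, Set.mem_Ico, div_le_iff₀ hpos, lt_div_iff₀ hpos, mul_comm]
  have hvol := (EuclideanSpace.volume_preserving_symm_measurableEquiv_toLp
    (Fin 2)).measureReal_preimage (s := box)
    (MeasurableSet.univ_pi fun i => measurableSet_Ico).nullMeasurableSet
  rw [hset]
  refine hvol.trans ?_
  simp only [hbox, Measure.real, Real.volume_pi_Ico, ← sub_div, add_sub_cancel_left, Finset.prod_const,
    Finset.card_univ, Fintype.card_fin, ENNReal.toReal_pow]
  rw [ENNReal.toReal_ofReal (by positivity), mul_comm 2 (n : ℤ), ← neg_mul, zpow_mul, zpow_ofNat,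
    zpow_neg, one_div]

/-- A lattice sum is the integral of the associated step function. -/
theorem integral_comp_cellIndex (n : ℕ) (f : (Fin 2 → ℤ) → ℝ)
    (hf : Integrable (fun x => f (cellIndex n x))) :
    ∫ x, f (cellIndex n x) = (2 : ℝ) ^ (-(2 * (n : ℤ))) * ∑' k, f k := by
  have hmeas := measurable_cellIndex n
  have hfm : Measurable f := measurable_of_countable f
  rw [← integral_map hmeas.aemeasurable hfm.aestronglyMeasurable,
    integral_countable ((integrable_map_measure hfm.aestronglyMeasurable hmeas.aemeasurable).2 hf),
    ← tsum_mul_left]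
  refine tsum_congr fun k => ?_
  rw [map_measureReal_apply hmeas (measurableSet_singleton k), volume_real_cellIndex_preimage,
    smul_eq_mul]

theorem tendsto_two_zpow_neg :
    Filter.Tendsto (fun n : ℕ => (2 : ℝ) ^ (-(n : ℤ))) Filter.atTop (nhds 0) := by
  simpa [zpow_neg] using tendsto_pow_atTop_nhds_zero_of_lt_one
    (inv_nonneg.2 zero_le_two) (inv_lt_one_of_one_lt₀ (one_lt_two (α := ℝ)))

theorem two_zpow_neg_sub_one (n : ℕ) :
    (2 : ℝ) ^ (-((n : ℤ) - 1)) = 2 * (2 : ℝ) ^ (-(n : ℤ)) := by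
  rw [neg_sub, sub_eq_add_neg, zpow_add₀ two_ne_zero, zpow_one]

theorem Hrad_pos (n : ℕ) : 0 < Hrad n := by
  unfold Hrad
  positivity

theorem tendsto_Hrad : Filter.Tendsto Hrad Filter.atTop (nhds 0) := by
  have h := (tendsto_rpow_neg_atTop (y := 1) one_pos).comp
    ((tendsto_rpow_atTop_of_base_gt_one 2 one_lt_two).comp
      (tendsto_natCast_atTop_atTop.atTop_div_const (two_pos (α := ℝ))))
  refine h.congr fun n => ?_
  simp [Hrad, Real.rpow_neg_one, ← Real.rpow_neg, neg_div]

theorem tendsto_Mthr {α : ℝ} (hα : 0 < α) :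
    Filter.Tendsto (Mthr α) Filter.atTop Filter.atTop := by
  have h : Filter.Tendsto (fun n => 2 * Hrad n) Filter.atTop (nhdsWithin 0 (Set.Ioi 0)) :=
    tendsto_nhdsWithin_iff.2 ⟨by simpa using tendsto_Hrad.const_mul 2,
      Filter.Eventually.of_forall fun n => mul_pos two_pos (Hrad_pos n)⟩
  exact (h.inv_tendsto_nhdsGT_zero).const_mul_atTop hα

/-- Almost every point outside `Ω` eventually lies in no admissible cell. -/
theorem ae_eventually_cellIndex_notMem_Kn {Ω : Set (EuclideanSpace ℝ (Fin 2))} {Cw : ℝ}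
    (hCw : 0 < Cw) : ∀ᵐ x ∂volume.restrict Ωᶜ,
      ∀ᶠ n : ℕ in Filter.atTop, cellIndex n x ∉ Kn Ω Cw n := by
  filter_upwards [IsUnifLocDoublingMeasure.ae_tendsto_measure_inter_div volume Ωᶜ Cw⁻¹] with x hx
  have hδ : Filter.Tendsto (fun n : ℕ => (2 : ℝ) ^ (-((n : ℤ) - 1)) * Cw) Filter.atTop
      (nhdsWithin 0 (Set.Ioi 0)) := by
    refine tendsto_nhdsWithin_iff.2 ⟨?_, Filter.Eventually.of_forall fun n =>
      mul_pos (by positivity) hCw⟩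
    simp_rw [two_zpow_neg_sub_one]
    simpa using (tendsto_two_zpow_neg.const_mul 2).mul_const Cw
  have h := hx (fun n : ℕ => (2 : ℝ) ^ (-(n : ℤ)) • ivec (cellIndex n x)) _ hδ
    (Filter.Eventually.of_forall fun n => by
      rw [mem_closedBall_iff_norm, mul_comm, mul_assoc, mul_inv_cancel₀ hCw.ne', mul_one,
        two_zpow_neg_sub_one]
      exact norm_sub_cellIndex_le n x)
  filter_upwards [h.eventually_ne one_ne_zero] with n hn hk
  refine hn ?_
  rw [Set.disjoint_iff_inter_eq_empty.1 (Set.disjoint_compl_left_iff_subset.2 hk), measure_empty,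
    ENNReal.zero_div]

/-- Every point of `Ω` eventually lies in an admissible cell. -/
theorem eventually_cellIndex_mem_Kn {Ω : Set (EuclideanSpace ℝ (Fin 2))} (hΩ : IsOpen Ω)
    (Cw : ℝ) {x : EuclideanSpace ℝ (Fin 2)} (hx : x ∈ Ω) :
    ∀ᶠ n : ℕ in Filter.atTop, cellIndex n x ∈ Kn Ω Cw n := by
  obtain ⟨r, hr, hball⟩ := Metric.isOpen_iff.1 hΩ x hx
  have hlim : Filter.Tendsto (fun n : ℕ => (2 : ℝ) ^ (-((n : ℤ) - 1)) * Cw +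
      2 * (2 : ℝ) ^ (-(n : ℤ))) Filter.atTop (nhds 0) := by
    simp_rw [two_zpow_neg_sub_one]
    simpa using ((tendsto_two_zpow_neg.const_mul 2).mul_const Cw).add
      (tendsto_two_zpow_neg.const_mul 2)
  filter_upwards [hlim.eventually_lt_const hr] with n hn
  refine fun y hy => hball ?_
  have h := norm_sub_cellIndex_le n x
  rw [← dist_eq_norm, dist_comm] at h
  exact (dist_triangle _ _ _).trans_lt ((add_le_add (Metric.mem_closedBall.1 hy) h).trans_lt hn)

theorem abs_cn_sub_le {Ω : Set (EuclideanSpace ℝ (Fin 2))} (hΩ : MeasurableSet Ω)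
    {φ : Fin 2 → EuclideanSpace ℝ (Fin 2) → ℝ} {Cw : ℝ}
    (hcont : ∀ j, Continuous (φ j)) (hnonneg : ∀ j y, 0 ≤ φ j y) (hne : ∀ j, ∃ y, φ j y ≠ 0)
    (hsupp : ∀ j, Function.support (φ j) ⊆ Metric.closedBall (0 : EuclideanSpace ℝ (Fin 2)) Cw)
    {u : EuclideanSpace ℝ (Fin 2) → ℝ} {B : ℝ} (hB : ∀ j, ∀ x ∈ Ω, |pd j u x| ≤ B)
    {n : ℕ} {k : Fin 2 → ℤ} (hk : k ∈ Kn Ω Cw n) {c : Fin 2 → ℝ} {ε : ℝ}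
    (hc : ∀ j, ∀ y ∈ Metric.closedBall ((2 : ℝ) ^ (-(n : ℤ)) • ivec k)
      ((2 : ℝ) ^ (-((n : ℤ) - 1)) * Cw), |pd j u y - c j| ≤ ε) :
    |cn Ω φ u n k - √(c 0 ^ 2 + c 1 ^ 2)| ≤ 2 * ε := by
  have h (j : Fin 2) : |cnj Ω φ u n j k - c j| ≤ ε :=
    abs_cnj_sub_le hΩ (hcont j) (hnonneg j) (hne j) (hsupp j) (hB j) hk (hc j)
  refine (abs_sqrt_sub_sqrt_le _ _ _ _).trans ?_
  linarith [h 0, h 1]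

/-- The rescaled admissible lattice lies in `Ω`. -/
theorem mem_of_mem_Kn {Ω : Set (EuclideanSpace ℝ (Fin 2))} {Cw : ℝ} (hCw : 0 < Cw) {n : ℕ}
    {k : Fin 2 → ℤ} (hk : k ∈ Kn Ω Cw n) : (2 : ℝ) ^ (-(n : ℤ)) • ivec k ∈ Ω :=
  hk (Metric.mem_closedBall_self (by positivity))

theorem chat_nonneg {Ω : Set (EuclideanSpace ℝ (Fin 2))}
    {φ : Fin 2 → EuclideanSpace ℝ (Fin 2) → ℝ} {Cw α : ℝ} (hα : 0 < α)
    {u : EuclideanSpace ℝ (Fin 2) → ℝ} (n : ℕ) (k : Fin 2 → ℤ) : 0 ≤ chat Ω φ Cw α u n k :=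
  le_min (div_nonneg hα.le (mul_pos two_pos (Hrad_pos n)).le)
    (Real.iSup_nonneg fun _ => Real.iSup_nonneg fun _ => Real.sqrt_nonneg _)

theorem chat_le {Ω : Set (EuclideanSpace ℝ (Fin 2))}
    {φ : Fin 2 → EuclideanSpace ℝ (Fin 2) → ℝ} {Cw α : ℝ}
    {u : EuclideanSpace ℝ (Fin 2) → ℝ} {n : ℕ} {k : Fin 2 → ℤ} {b : ℝ} (hb : 0 ≤ b)
    (h : ∀ l ∈ Bnk Ω Cw n k, cn Ω φ u n l ≤ b) : chat Ω φ Cw α u n k ≤ b :=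
  (min_le_right _ _).trans (biSup_le_of_forall_mem_le hb h)

/-- If the coefficients near `k` are close to `G` and below the threshold, so is `ĉ_n[u;k]`. -/
theorem abs_chat_sub_le {Ω : Set (EuclideanSpace ℝ (Fin 2))}
    {φ : Fin 2 → EuclideanSpace ℝ (Fin 2) → ℝ} {Cw α : ℝ}
    {u : EuclideanSpace ℝ (Fin 2) → ℝ} {n : ℕ} {k : Fin 2 → ℤ} (hk : k ∈ Kn Ω Cw n)
    {G ε : ℝ} (hG : 0 ≤ G) (hε : 0 ≤ ε) (hM : G + ε ≤ Mthr α n)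
    (h : ∀ l ∈ Bnk Ω Cw n k, |cn Ω φ u n l - G| ≤ ε) : |chat Ω φ Cw α u n k - G| ≤ ε := by
  have hub : ∀ l ∈ Bnk Ω Cw n k, cn Ω φ u n l ≤ G + ε := fun l hl => by
    linarith [(abs_le.1 (h l hl)).2]
  have hkB : k ∈ Bnk Ω Cw n k := ⟨hk, by simpa using (Hrad_pos n).le⟩
  have hle := chat_le (α := α) (add_nonneg hG hε) hub
  have hge : G - ε ≤ chat Ω φ Cw α u n k := by
    refine le_min (by linarith) (le_trans ?_ (le_biSup_of_mem (add_nonneg hG hε) hub hkB))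
    linarith [(abs_le.1 (h k hkB)).1]
  exact abs_le.2 ⟨by linarith, by linarith⟩

/-- Inside `Ω`, the truncated coefficients converge pointwise to the length of the gradient. -/
theorem tendsto_chat_cellIndex {Ω : Set (EuclideanSpace ℝ (Fin 2))} (hΩ : IsOpen Ω)
    {φ : Fin 2 → EuclideanSpace ℝ (Fin 2) → ℝ} {Cw : ℝ}
    (hcont : ∀ j, Continuous (φ j)) (hnonneg : ∀ j y, 0 ≤ φ j y) (hne : ∀ j, ∃ y, φ j y ≠ 0)
    (hsupp : ∀ j, Function.support (φ j) ⊆ Metric.closedBall (0 : EuclideanSpace ℝ (Fin 2)) Cw)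
    {α : ℝ} (hα : 0 < α)
    {u : EuclideanSpace ℝ (Fin 2) → ℝ} {B : ℝ} (hB : ∀ j, ∀ x ∈ Ω, |pd j u x| ≤ B)
    (huc : ∀ ε : ℝ, 0 < ε → ∃ δ : ℝ, 0 < δ ∧ ∀ x ∈ Ω, ∀ y ∈ Ω, dist x y < δ →
      ∀ j, |pd j u x - pd j u y| < ε)
    {x : EuclideanSpace ℝ (Fin 2)} (hx : x ∈ Ω) :
    Filter.Tendsto (fun n : ℕ => chat Ω φ Cw α u n (cellIndex n x)) Filter.atTop
      (nhds √(pd 0 u x ^ 2 + pd 1 u x ^ 2)) := by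
  refine Metric.tendsto_nhds.2 fun ε hε => ?_
  obtain ⟨δ, hδ, huδ⟩ := huc (ε / 4) (by positivity)
  have hlim : Filter.Tendsto (fun n : ℕ => (2 : ℝ) ^ (-((n : ℤ) - 1)) * Cw + Hrad n +
      2 * (2 : ℝ) ^ (-(n : ℤ))) Filter.atTop (nhds 0) := by
    simp_rw [two_zpow_neg_sub_one]
    simpa using (((tendsto_two_zpow_neg.const_mul 2).mul_const Cw).add tendsto_Hrad).add
      (tendsto_two_zpow_neg.const_mul 2)
  filter_upwards [hlim.eventually_lt_const hδ, eventually_cellIndex_mem_Kn hΩ Cw hx,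
    (tendsto_Mthr hα).eventually_ge_atTop (√(pd 0 u x ^ 2 + pd 1 u x ^ 2) + 2 * (ε / 4))]
    with n hn hk hM
  rw [Real.dist_eq]
  refine (abs_chat_sub_le hk (Real.sqrt_nonneg _) (by positivity) hM fun l hl => ?_).trans_lt
    (by linarith)
  refine abs_cn_sub_le hΩ.measurableSet hcont hnonneg hne hsupp hB hl.1
    (c := fun j => pd j u x) fun j y hy => (huδ y (hl.1 hy) x hx ?_ j).le
  have hcell := norm_sub_cellIndex_le n x
  rw [← dist_eq_norm, dist_comm] at hcell
  have hlk := hl.2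
  rw [← dist_eq_norm] at hlk
  exact (dist_triangle4 _ _ _ _).trans_lt
    ((add_le_add (add_le_add (Metric.mem_closedBall.1 hy) hlk) hcell).trans_lt hn)

/-- for `u` of class `C¹` on `Ω` with bounded, uniformly continuous
gradient, the regularity energies converge: `R_n(u) → ∫_Ω |∇u|`. -/
theorem stmt10 (Ω : Set (EuclideanSpace ℝ (Fin 2))) (hΩopen : IsOpen Ω)
    (hΩne : Ω.Nonempty) (hΩbdd : Bornology.IsBounded Ω)
    (φ : Fin 2 → EuclideanSpace ℝ (Fin 2) → ℝ) (Cw : ℝ) (hCw : 0 < Cw)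
    (hφcont : ∀ j, Continuous (φ j)) (hφnonneg : ∀ j y, 0 ≤ φ j y)
    (hφne : ∀ j, ∃ y, φ j y ≠ 0)
    (hφsupp : ∀ j, Function.support (φ j) ⊆
      Metric.closedBall (0 : EuclideanSpace ℝ (Fin 2)) Cw)
    (α : ℝ) (hα : 0 < α)
    (u : EuclideanSpace ℝ (Fin 2) → ℝ) (hu : ContDiffOn ℝ 1 u Ω)
    (hgradbdd : ∃ B : ℝ, ∀ x ∈ Ω, Real.sqrt (pd 0 u x ^ 2 + pd 1 u x ^ 2) ≤ B)
    (hgraduc : ∀ ε : ℝ, 0 < ε → ∃ δ : ℝ, 0 < δ ∧ ∀ x ∈ Ω, ∀ y ∈ Ω, dist x y < δ →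
      Real.sqrt ((pd 0 u x - pd 0 u y) ^ 2 + (pd 1 u x - pd 1 u y) ^ 2) < ε) :
    Filter.Tendsto (fun n : ℕ => Rn Ω φ Cw α u n) Filter.atTop
      (nhds (∫ x in Ω, Real.sqrt (pd 0 u x ^ 2 + pd 1 u x ^ 2))) := by
  obtain ⟨B, hB⟩ := hgradbdd
  have hpd : ∀ j, ∀ x ∈ Ω, |pd j u x| ≤ B := fun j x hx => by
    refine le_trans (Real.abs_le_sqrt ?_) (hB x hx)
    fin_cases j
    · exact le_add_of_nonneg_right (sq_nonneg _)
    · exact le_add_of_nonneg_left (sq_nonneg _)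
  have hB0 : 0 ≤ B := (abs_nonneg _).trans (hpd 0 _ hΩne.some_mem)
  have huc : ∀ ε : ℝ, 0 < ε → ∃ δ : ℝ, 0 < δ ∧ ∀ x ∈ Ω, ∀ y ∈ Ω, dist x y < δ →
      ∀ j, |pd j u x - pd j u y| < ε := fun ε hε => by
    obtain ⟨δ, hδ, h⟩ := hgraduc ε hε
    refine ⟨δ, hδ, fun x hx y hy hxy j => lt_of_le_of_lt (Real.abs_le_sqrt ?_) (h x hx y hy hxy)⟩
    fin_cases j
    · exact le_add_of_nonneg_right (sq_nonneg _)
    · exact le_add_of_nonneg_left (sq_nonneg _)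
  have hcn (n : ℕ) (l : Fin 2 → ℤ) (hl : l ∈ Kn Ω Cw n) : cn Ω φ u n l ≤ 2 * B := by
    have h := abs_cn_sub_le hΩopen.measurableSet hφcont hφnonneg hφne hφsupp hpd hl
      (c := fun _ => 0) (ε := B) fun j y hy => by simpa using hpd j y (hl hy)
    simpa using (le_abs_self _).trans h
  obtain ⟨R, hR⟩ := hΩbdd.subset_closedBall 0
  set F : ℕ → EuclideanSpace ℝ (Fin 2) → ℝ :=
    fun n x => (Kn Ω Cw n).indicator (chat Ω φ Cw α u n) (cellIndex n x) with hF
  set bound : EuclideanSpace ℝ (Fin 2) → ℝ :=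
    (Metric.closedBall 0 (R + 2)).indicator fun _ => 2 * B with hbound
  have hFmeas (n : ℕ) : AEStronglyMeasurable (F n) volume :=
    ((measurable_of_countable ((Kn Ω Cw n).indicator (chat Ω φ Cw α u n))).comp
      (measurable_cellIndex n)).aestronglyMeasurable
  have hboundint : Integrable bound :=
    (integrable_indicator_iff Metric.isClosed_closedBall.measurableSet).2
      (integrableOn_const measure_closedBall_lt_top.ne)
  have hFbound (n : ℕ) (x : EuclideanSpace ℝ (Fin 2)) : ‖F n x‖ ≤ bound x := by
    by_cases hk : cellIndex n x ∈ Kn Ω Cw n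
    · have hx : x ∈ Metric.closedBall (0 : EuclideanSpace ℝ (Fin 2)) (R + 2) := by
        have h₁ := hR (mem_of_mem_Kn hCw hk)
        have h₂ := norm_sub_cellIndex_le n x
        have h₃ : (2 : ℝ) ^ (-(n : ℤ)) ≤ 1 := zpow_le_one_of_nonpos₀ one_le_two (by simp)
        rw [mem_closedBall_zero_iff] at h₁ ⊢
        linarith [norm_le_norm_add_norm_sub ((2 : ℝ) ^ (-(n : ℤ)) • ivec (cellIndex n x)) x,
          norm_sub_rev x ((2 : ℝ) ^ (-(n : ℤ)) • ivec (cellIndex n x))]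
      simp only [hF, hbound, Set.indicator_of_mem hk, Set.indicator_of_mem hx]
      rw [Real.norm_of_nonneg (chat_nonneg hα n _)]
      exact chat_le (by positivity) fun l hl => hcn n l hl.1
    · simp only [hF, Set.indicator_of_notMem hk, norm_zero]
      exact Set.indicator_nonneg (fun _ _ => by positivity) x
  have hlim : ∀ᵐ x, Filter.Tendsto (fun n => F n x) Filter.atTop
      (nhds (Ω.indicator (fun x => √(pd 0 u x ^ 2 + pd 1 u x ^ 2)) x)) := by
    filter_upwards [(ae_restrict_iff' hΩopen.measurableSet.compl).1
      (ae_eventually_cellIndex_notMem_Kn (Ω := Ω) hCw)] with x hout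
    by_cases hx : x ∈ Ω
    · rw [Set.indicator_of_mem hx]
      refine (tendsto_chat_cellIndex hΩopen hφcont hφnonneg hφne hφsupp hα hpd huc hx).congr' ?_
      filter_upwards [eventually_cellIndex_mem_Kn hΩopen Cw hx] with n hn
      exact (Set.indicator_of_mem hn _).symm
    · rw [Set.indicator_of_notMem hx]
      refine tendsto_const_nhds.congr' ?_
      filter_upwards [hout hx] with n hn
      exact (Set.indicator_of_notMem hn _).symm
  rw [← integral_indicator hΩopen.measurableSet]
  refine (tendsto_integral_of_dominated_convergence bound hFmeas hboundint
    (fun n => Filter.Eventually.of_forall (hFbound n)) hlim).congr fun n => ?_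
  rw [Rn, tsum_subtype, ← integral_comp_cellIndex n _
    (hboundint.mono' (hFmeas n) (Filter.Eventually.of_forall (hFbound n)))]
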